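/- Let m ∈ ℕ and c ∈ ℤ. Then the polynomial x ↦ Φ_m(c·x) is a Generalised Euclid–Mullin polynomial for the progression 1 mod m if and only if c ∈ S(m). -/

import Mathlib

open Polynomial

/-- `f` is a Generalised Euclid–Mullin polynomial for the progression `a mod m`:
(i) `f(1) ≠ 0` and (ii) for every positive `n` with `gcd(n, f(0)) = 1` and `n ≡ a^k (mod m)`
for some `k`, `f(n)` has a prime divisor `p` with `p ∤ f(0)` and `p ≡ a (mod m)`. -/
def IsGEMPoly (a m : ℕ) (f : Polynomial ℤ) : Prop :=
  f.eval 1 ≠ 0 ∧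
  ∀ n : ℕ, 0 < n → Int.gcd (n : ℤ) (f.eval 0) = 1 → (∃ k : ℕ, n ≡ a ^ k [MOD m]) →
    ∃ p : ℕ, p.Prime ∧ (p : ℤ) ∣ f.eval (n : ℤ) ∧ ¬ (p : ℤ) ∣ f.eval 0 ∧ p ≡ a [MOD m]

/-- The set `S(m)` of admissible values of `c`. -/
def Sset (m : ℕ) : Set ℤ :=
  if m = 1 then {c : ℤ | c ≠ 0 ∧ c ≠ 1 ∧ c ≠ 2}
  else if m = 2 then
    {c : ℤ | 0 < c ∧ 2 ∣ c} ∪ {c : ℤ | c < 0 ∧ ∀ k : ℕ, ¬ (-c) ∣ (2 ^ k + 1)}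
  else if m = 3 then {c : ℤ | c ≠ -2 ∧ c ≠ -1 ∧ c ≠ 0 ∧ c ≠ 1}
  else if m = 6 then {c : ℤ | c ≠ -1 ∧ c ≠ 0 ∧ c ≠ 1 ∧ c ≠ 2}
  else {c : ℤ | c ≠ -1 ∧ c ≠ 0 ∧ c ≠ 1}

namespace Polynomial

theorem norm_eval_cyclotomic_eq_prod {n : ℕ} (hn : 0 < n) (a : ℤ) :
    |(((cyclotomic n ℤ).eval a : ℤ) : ℝ)| = ∏ ζ ∈ primitiveRoots n ℂ, ‖(a : ℂ) - ζ‖ := by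
  have h := eval_intCast_map (Int.castRingHom ℂ) (cyclotomic n ℤ) a
  rw [map_cyclotomic_int, cyclotomic_eq_prod_X_sub_primitiveRoots
    (Complex.isPrimitiveRoot_exp n hn.ne')] at h
  simp only [eval_prod, eval_sub, eval_X, eval_C, eq_intCast, Int.cast_id] at h
  rw [← norm_prod, h, Complex.norm_intCast]

theorem abs_sub_one_pow_totient_le_abs_eval_cyclotomic {n : ℕ} (hn : 0 < n) {a : ℤ}
    (ha : 1 ≤ |a|) : (|a| - 1) ^ n.totient ≤ |(cyclotomic n ℤ).eval a| := by
  have ha' : (1 : ℝ) ≤ |(a : ℝ)| := by exact_mod_cast ha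
  have key : (|(a : ℝ)| - 1) ^ n.totient ≤ |(((cyclotomic n ℤ).eval a : ℤ) : ℝ)| := by
    rw [norm_eval_cyclotomic_eq_prod hn, ← Complex.card_primitiveRoots, ← Finset.prod_const]
    refine Finset.prod_le_prod (fun _ _ => by linarith) fun ζ hζ => ?_
    have h1 := (isPrimitiveRoot_of_mem_primitiveRoots hζ).norm'_eq_one hn.ne'
    have h2 := norm_sub_norm_le (a : ℂ) ζ
    rwa [h1, Complex.norm_intCast] at h2
  exact_mod_cast key

theorem abs_eval_cyclotomic_le_abs_add_one_pow_totient {n : ℕ} (hn : 0 < n) (a : ℤ) :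
    |(cyclotomic n ℤ).eval a| ≤ (|a| + 1) ^ n.totient := by
  have key : |(((cyclotomic n ℤ).eval a : ℤ) : ℝ)| ≤ (|(a : ℝ)| + 1) ^ n.totient := by
    rw [norm_eval_cyclotomic_eq_prod hn, ← Complex.card_primitiveRoots, ← Finset.prod_const]
    refine Finset.prod_le_prod (fun _ _ => norm_nonneg _) fun ζ hζ => ?_
    have h1 := (isPrimitiveRoot_of_mem_primitiveRoots hζ).norm'_eq_one hn.ne'
    have h2 := norm_sub_le (a : ℂ) ζ
    rwa [h1, Complex.norm_intCast] at h2
  exact_mod_cast key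

theorem abs_sub_one_pow_totient_lt_abs_eval_cyclotomic {n : ℕ} (hn : 2 < n) {a : ℤ}
    (ha : 2 ≤ |a|) : (|a| - 1) ^ n.totient < |(cyclotomic n ℤ).eval a| := by
  have hn0 : 0 < n := by lia
  have ha' : (2 : ℝ) ≤ |(a : ℝ)| := by exact_mod_cast ha
  have key : (|(a : ℝ)| - 1) ^ n.totient < |(((cyclotomic n ℤ).eval a : ℤ) : ℝ)| := by
    rw [norm_eval_cyclotomic_eq_prod hn0, ← Complex.card_primitiveRoots, ← Finset.prod_const]
    refine Finset.prod_lt_prod_of_nonempty (fun _ _ => by linarith) (fun ζ hζ => ?_)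
      ⟨_, (mem_primitiveRoots hn0).2 (Complex.isPrimitiveRoot_exp n hn0.ne')⟩
    have hprim := isPrimitiveRoot_of_mem_primitiveRoots hζ
    have h1 := hprim.norm'_eq_one hn0.ne'
    have him : ζ.im ≠ 0 := fun him => by
      have hsq : ζ ^ 2 = 1 := by
        have h3 := Complex.normSq_eq_norm_sq ζ
        rw [h1, Complex.normSq_apply, him] at h3
        apply Complex.ext <;> simp [pow_two, him]
        linarith
      have := Nat.le_of_dvd two_pos (hprim.dvd_of_pow_eq_one 2 hsq)
      lia
    have h3 := Complex.normSq_eq_norm_sq ζ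
    rw [h1, Complex.normSq_apply] at h3
    have h4 := Complex.normSq_eq_norm_sq ((a : ℂ) - ζ)
    rw [Complex.normSq_apply] at h4
    simp only [Complex.sub_re, Complex.intCast_re, Complex.sub_im, Complex.intCast_im] at h4
    have him2 : 0 < ζ.im * ζ.im := mul_self_pos.2 him
    have hre : |ζ.re| < 1 := by
      rw [← sq_lt_one_iff_abs_lt_one]; nlinarith
    have h5 : a * ζ.re < |(a : ℝ)| := by
      calc a * ζ.re ≤ |a * ζ.re| := le_abs_self _
        _ = |(a : ℝ)| * |ζ.re| := abs_mul _ _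
        _ < |(a : ℝ)| := by nlinarith
    refine lt_of_pow_lt_pow_left₀ 2 (norm_nonneg _) ?_
    nlinarith [sq_abs (a : ℝ)]
  exact_mod_cast key

theorem exists_isPrimitiveRoot_of_dvd_eval_cyclotomic {m p : ℕ} (hm : 0 < m) (hp : p.Prime)
    {a : ℤ} (h : (p : ℤ) ∣ (cyclotomic m ℤ).eval a) :
    ∃ k r, m = p ^ k * r ∧ ¬ p ∣ r ∧ IsPrimitiveRoot (a : ZMod p) r := by
  have := Fact.mk hp
  obtain ⟨k, r, hr, rfl⟩ := Nat.exists_eq_pow_mul_and_not_dvd hm.ne' p hp.ne_one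
  have : NeZero (r : ZMod p) := ⟨by rwa [Ne, ZMod.natCast_eq_zero_iff]⟩
  refine ⟨k, r, rfl, hr, (isRoot_cyclotomic_prime_pow_mul_iff_of_charP (p := p) (k := k)).1 ?_⟩
  have h1 := eval_intCast_map (Int.castRingHom (ZMod p)) (cyclotomic (p ^ k * r) ℤ) a
  rw [map_cyclotomic_int] at h1
  rw [IsRoot, h1, eq_intCast, ZMod.intCast_zmod_eq_zero_iff_dvd]
  exact h

theorem isPrimitiveRoot_of_dvd_eval_cyclotomic {m p : ℕ} (hm : 0 < m) (hp : p.Prime)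
    (hpm : ¬ p ∣ m) {a : ℤ} (h : (p : ℤ) ∣ (cyclotomic m ℤ).eval a) :
    IsPrimitiveRoot (a : ZMod p) m := by
  obtain ⟨k, r, rfl, -, hprim⟩ := exists_isPrimitiveRoot_of_dvd_eval_cyclotomic hm hp h
  obtain rfl : k = 0 := by
    by_contra hk
    exact hpm ((dvd_pow_self p hk).mul_right r)
  simpa using hprim

theorem _root_.IsPrimitiveRoot.dvd_prime_sub_one {p r : ℕ} (hp : p.Prime) {x : ZMod p}
    (h : IsPrimitiveRoot x r) (hr : r ≠ 0) : r ∣ p - 1 := by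
  have := Fact.mk hp
  exact h.dvd_of_pow_eq_one _ (ZMod.pow_card_sub_one_eq_one (h.ne_zero hr))

theorem eval_cyclotomic_dvd_geom_sum {m p : ℕ} (hm : 0 < m) (hp : 1 < p) (hpm : p ∣ m) {a : ℤ}
    (ha : 2 ≤ |a|) :
    (cyclotomic m ℤ).eval a ∣ ∑ i ∈ Finset.range p, (a ^ (m / p)) ^ i := by
  have hd : m / p ∈ m.properDivisors :=
    Nat.mem_properDivisors.2 ⟨Nat.div_dvd_of_dvd hpm, Nat.div_lt_self hm hp⟩
  have h := _root_.map_dvd (evalRingHom a) (X_pow_sub_one_mul_cyclotomic_dvd_X_pow_sub_one_of_dvd ℤ hd)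
  simp only [coe_evalRingHom, eval_mul, eval_sub, eval_pow, eval_X, eval_one] at h
  have hpow : a ^ m = (a ^ (m / p)) ^ p := by rw [← pow_mul, Nat.div_mul_cancel hpm]
  rw [hpow, ← mul_geom_sum (a ^ (m / p)) p] at h
  refine (mul_dvd_mul_iff_left fun h0 => ?_).1 h
  have h1 : |a ^ (m / p)| = 1 := by rw [sub_eq_zero.1 h0, abs_one]
  rw [abs_pow] at h1
  have := one_lt_pow₀ (show 1 < |a| by lia)
    (Nat.div_pos (Nat.le_of_dvd hm hpm) (by lia)).ne'
  lia

theorem not_sq_dvd_eval_cyclotomic {m p : ℕ} (hm : 2 < m) (hp : p.Prime) (hpm : p ∣ m) {a : ℤ}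
    (ha : 2 ≤ |a|) : ¬ (p : ℤ) ^ 2 ∣ (cyclotomic m ℤ).eval a := by
  intro h
  obtain ⟨k, r, hmr, hpr, hprim⟩ := exists_isPrimitiveRoot_of_dvd_eval_cyclotomic (by lia) hp
    ((dvd_pow_self _ two_ne_zero).trans h)
  have hsum := h.trans (eval_cyclotomic_dvd_geom_sum (by lia) hp.one_lt hpm ha)
  have hr0 : r ≠ 0 := by rintro rfl; simp at hpr
  obtain ⟨k, rfl⟩ : ∃ j, k = j + 1 := Nat.exists_eq_succ_of_ne_zero <| by
    rintro rfl
    rw [hmr] at hpm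
    simp [hpr] at hpm
  have hdiv : m / p = p ^ k * r := by
    rw [hmr, pow_succ, mul_right_comm, Nat.mul_div_cancel _ hp.pos]
  have hy : (p : ℤ) ∣ a ^ (m / p) - 1 := by
    rw [← ZMod.intCast_zmod_eq_zero_iff_dvd, hdiv, mul_comm, pow_mul]
    simp [hprim.pow_eq_one]
  rcases hp.eq_two_or_odd' with rfl | hodd
  · have hr1 : r = 1 := by
      have := hprim.dvd_prime_sub_one hp hr0
      simpa using this
    subst hr1
    obtain ⟨k, rfl⟩ : ∃ j, k = j + 1 := Nat.exists_eq_succ_of_ne_zero <| by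
      rintro rfl
      simp at hmr
      lia
    have haodd : Odd (a ^ 2 ^ k) := by
      rw [hdiv, mul_one, pow_succ, pow_mul] at hy
      have : Odd ((a ^ 2 ^ k) ^ 2) := by
        obtain ⟨t, ht⟩ := hy
        exact ⟨t, by push_cast at ht; lia⟩
      exact (Int.odd_pow' two_ne_zero).1 this
    have := Int.sq_mod_four_eq_one_of_odd haodd
    rw [hdiv, mul_one, pow_succ 2 k, pow_mul, Finset.sum_range_succ, Finset.sum_range_one] at hsum
    simp only [pow_zero, pow_one, Nat.cast_ofNat] at hsum
    lia
  · obtain ⟨t, ht⟩ := hy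
    have h1 := odd_sq_dvd_geom_sum₂_sub (1 : ℤ) t hodd
    rw [← eq_add_of_sub_eq' ht] at h1
    simp only [one_pow, mul_one] at h1
    have h2 := (dvd_sub_right hsum).1 h1
    have h3 : p ^ 2 ∣ p := by exact_mod_cast h2
    have := Nat.le_of_dvd hp.pos h3
    nlinarith [hp.two_le]

theorem lt_abs_eval_cyclotomic {m p r k : ℕ} (hm : 2 < m) (hp : p.Prime)
    (hmr : m = p ^ (k + 1) * r) (hpr : ¬ p ∣ r) (hr : r ∣ p - 1) {a : ℤ} (ha : 2 ≤ |a|)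
    (h3 : ¬ (m = 3 ∧ a = -2)) (h6 : ¬ (m = 6 ∧ a = 2)) :
    (p : ℤ) < |(cyclotomic m ℤ).eval a| := by
  have hr0 : 0 < r := Nat.pos_of_ne_zero <| by rintro rfl; simp at hpr
  have htot : ∀ n, 0 < n → p ∣ n → p - 1 ≤ n.totient := fun n hn hpn => by
    rw [← Nat.totient_prime hp]
    exact Nat.le_of_dvd (Nat.totient_pos.2 hn) (Nat.totient_dvd_of_dvd hpn)
  have hp1 : p - 1 + 1 = p := Nat.sub_add_cancel hp.one_le
  rcases k with _ | k
  · rw [zero_add, pow_one] at hmr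
    rcases ha.eq_or_lt with ha2 | ha3
    · rcases hp.eq_two_or_odd' with rfl | hodd
      · have : r = 1 := by simpa using hr
        lia
      rcases (show 3 ≤ p by have := hp.two_le; rcases hodd with ⟨t, rfl⟩; lia).eq_or_lt
        with rfl | hp3
      · have hr2 : r = 1 ∨ r = 2 := by
          have := Nat.le_of_dvd (by simp) hr
          lia
        rcases (abs_eq (by simp)).1 ha2.symm with rfl | rfl <;> rcases hr2 with rfl | rfl <;>
          subst hmr
        · simp
        · simp at h6
        · simp at h3
        · simp [cyclotomic_six]
      · have hexp := congrArg (eval a) (cyclotomic_expand_eq_cyclotomic_mul hp hpr ℤ)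
        rw [expand_eval, eval_mul, mul_comm r p, ← hmr] at hexp
        have hlow := abs_sub_one_pow_totient_le_abs_eval_cyclotomic (a := a ^ p) hr0
          (by rw [abs_pow]; exact one_le_pow₀ (by lia))
        have hupp := abs_eval_cyclotomic_le_abs_add_one_pow_totient hr0 a
        rw [hexp, abs_mul, abs_pow, ← ha2] at hlow
        rw [← ha2] at hupp
        have hbig : (p : ℤ) * 3 < 2 ^ p - 1 := by
          have : ∀ n : ℕ, 4 < n → (n : ℤ) * 3 < 2 ^ n - 1 := fun n hn => by
            induction n, hn using Nat.le_induction with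
            | base => norm_num
            | succ n hn ih => push_cast; rw [pow_succ]; lia
          refine this p ?_
          rcases hodd with ⟨t, rfl⟩
          lia
        have htr := Nat.totient_pos.2 hr0
        by_contra! hle
        have h1 : ((p : ℤ) * 3) ^ r.totient < (2 ^ p - 1) ^ r.totient :=
          pow_lt_pow_left₀ hbig (by positivity) htr.ne'
        have h2 : (p : ℤ) ≤ (p : ℤ) ^ r.totient :=
          le_self_pow₀ (by exact_mod_cast hp.one_le) htr.ne'
        rw [mul_pow] at h1
        have h3 : |(cyclotomic m ℤ).eval a| * |(cyclotomic r ℤ).eval a| ≤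
            (p : ℤ) ^ r.totient * 3 ^ r.totient :=
          mul_le_mul (hle.trans h2) (by simpa using hupp) (abs_nonneg _) (by positivity)
        lia
    · refine lt_of_le_of_lt ?_ (abs_sub_one_pow_totient_lt_abs_eval_cyclotomic hm ha)
      calc (p : ℤ) ≤ 2 ^ (p - 1) := by
            have := (p - 1).lt_two_pow_self
            exact_mod_cast (show p ≤ 2 ^ (p - 1) by lia)
        _ ≤ 2 ^ m.totient := pow_le_pow_right₀ (by simp)
            (htot m (by lia) (hmr ▸ dvd_mul_right p r))
        _ ≤ _ := pow_le_pow_left₀ (by simp) (by lia) _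
  · have hexp := congrArg (eval a) (cyclotomic_expand_eq_cyclotomic (n := p ^ (k + 1) * r) hp
      ((dvd_pow_self p k.succ_ne_zero).mul_right r) ℤ)
    rw [expand_eval, mul_right_comm, ← pow_succ, ← hmr] at hexp
    have hn : 0 < p ^ (k + 1) * r := by have := hp.pos; positivity
    have hap : 4 ≤ |a ^ p| := by
      rw [abs_pow]
      calc (4 : ℤ) = 2 ^ 2 := by norm_num
        _ ≤ |a| ^ 2 := pow_le_pow_left₀ (by simp) ha 2
        _ ≤ |a| ^ p := pow_le_pow_right₀ (by lia) hp.two_le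
    rw [← hexp]
    refine lt_of_lt_of_le ?_ (abs_sub_one_pow_totient_le_abs_eval_cyclotomic hn (by lia))
    calc (p : ℤ) < 3 ^ (p - 1) := by
          have h : ∀ n : ℕ, 0 < n → n + 1 < 3 ^ n := fun n hn => by
            induction n, hn using Nat.le_induction with
            | base => norm_num
            | succ n hn ih => rw [pow_succ]; lia
          have := h (p - 1) (by have := hp.two_le; lia)
          rw [hp1] at this
          exact_mod_cast this
      _ ≤ 3 ^ (p ^ (k + 1) * r).totient := pow_le_pow_right₀ (by simp)
          (htot _ hn ((dvd_pow_self p k.succ_ne_zero).mul_right r))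
      _ ≤ _ := pow_le_pow_left₀ (by simp) (by lia) _

/-- Zsigmondy's theorem for values of cyclotomic polynomials. -/
theorem exists_prime_dvd_eval_cyclotomic_modEq_one {m : ℕ} (hm : 2 < m) {a : ℤ} (ha : 2 ≤ |a|)
    (h3 : ¬ (m = 3 ∧ a = -2)) (h6 : ¬ (m = 6 ∧ a = 2)) :
    ∃ p : ℕ, p.Prime ∧ (p : ℤ) ∣ (cyclotomic m ℤ).eval a ∧ p ≡ 1 [MOD m] := by
  have hm0 : 0 < m := by lia
  by_contra! hno
  have hdvd : ∀ q : ℕ, q.Prime → (q : ℤ) ∣ (cyclotomic m ℤ).eval a → q ∣ m :=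
    fun q hq hqN => by
      by_contra hqm
      have := (isPrimitiveRoot_of_dvd_eval_cyclotomic hm0 hq hqm hqN).dvd_prime_sub_one hq hm0.ne'
      exact hno q hq hqN ((Nat.modEq_iff_dvd' hq.one_le).2 this).symm
  have hrep : ∀ q : ℕ, q.Prime → (q : ℤ) ∣ (cyclotomic m ℤ).eval a →
      ∃ k r, m = q ^ (k + 1) * r ∧ ¬ q ∣ r ∧ r ∣ q - 1 := fun q hq hqN => by
    obtain ⟨k, r, hmr, hqr, hprim⟩ := exists_isPrimitiveRoot_of_dvd_eval_cyclotomic hm0 hq hqN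
    obtain ⟨k, rfl⟩ : ∃ j, k = j + 1 := Nat.exists_eq_succ_of_ne_zero <| by
      rintro rfl
      exact hqr (by simpa [hmr] using hdvd q hq hqN)
    exact ⟨k, r, hmr, hqr, hprim.dvd_prime_sub_one hq (by rintro rfl; simp at hqr)⟩
  have hle : ∀ p q : ℕ, p.Prime → q.Prime → (p : ℤ) ∣ (cyclotomic m ℤ).eval a →
      (q : ℤ) ∣ (cyclotomic m ℤ).eval a → q ≤ p := fun p q hp hq hpN hqN => by
    obtain ⟨k, r, hmr, hpr, hr⟩ := hrep p hp hpN
    have h := hdvd q hq hqN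
    rw [hmr] at h
    rcases hq.dvd_mul.1 h with h | h
    · exact Nat.le_of_dvd hp.pos (hq.dvd_of_dvd_pow h)
    · have := Nat.le_of_dvd (by have := hp.two_le; lia) (h.trans hr)
      lia
  have hN1 : 1 < |(cyclotomic m ℤ).eval a| :=
    lt_of_le_of_lt (one_le_pow₀ (by lia)) (abs_sub_one_pow_totient_lt_abs_eval_cyclotomic hm ha)
  rw [Int.abs_eq_natAbs] at hN1
  obtain ⟨p, hp, hpN⟩ := Nat.exists_prime_and_dvd (n := ((cyclotomic m ℤ).eval a).natAbs) (by lia)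
  rw [← Int.natCast_dvd] at hpN
  obtain ⟨k, r, hmr, hpr, hr⟩ := hrep p hp hpN
  have hlt := lt_abs_eval_cyclotomic hm hp hmr hpr hr ha h3 h6
  rw [Int.abs_eq_natAbs] at hlt
  have hpow := Nat.eq_prime_pow_of_unique_prime_dvd (p := p)
    (n := ((cyclotomic m ℤ).eval a).natAbs) (by lia) fun {d} hd hdN => by
      rw [← Int.natCast_dvd] at hdN
      exact le_antisymm (hle p d hp hd hpN hdN) (hle d p hd hp hdN hpN)
  refine not_sq_dvd_eval_cyclotomic hm hp (hdvd p hp hpN) ha ?_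
  rw [← Nat.cast_pow, Int.natCast_dvd, hpow]
  refine pow_dvd_pow p ?_
  by_contra! hlen
  have := Nat.pow_le_pow_right hp.pos (Nat.le_of_lt_succ hlen)
  lia

end Polynomial

theorem isGEMPoly_one_cyclotomic_comp_iff {m : ℕ} {c : ℤ} :
    IsGEMPoly 1 m ((cyclotomic m ℤ).comp (C c * X)) ↔
      (cyclotomic m ℤ).eval c ≠ 0 ∧ ∀ n : ℕ, 0 < n → n ≡ 1 [MOD m] →
        ∃ p : ℕ, p.Prime ∧ (p : ℤ) ∣ (cyclotomic m ℤ).eval (c * n) ∧ p ≡ 1 [MOD m] := by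
  have h0 : IsUnit ((cyclotomic m ℤ).eval 0) := by
    rcases lt_trichotomy m 1 with h | rfl | h
    · obtain rfl : m = 0 := by lia
      simp
    · simp
    · rw [← coeff_zero_eq_eval_zero, cyclotomic_coeff_zero ℤ h]
      exact isUnit_one
  have hgcd : ∀ n : ℕ, Int.gcd n ((cyclotomic m ℤ).eval 0) = 1 := fun n =>
    by
    rw [Int.gcd_eq_natAbs, Int.natAbs_of_isUnit h0, Nat.gcd_one_right]
  have hndvd : ∀ p : ℕ, p.Prime → ¬ (p : ℤ) ∣ (cyclotomic m ℤ).eval 0 := fun p hp h =>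
    (Nat.prime_iff_prime_int.1 hp).not_isUnit (isUnit_of_dvd_unit h h0)
  simp only [IsGEMPoly, eval_comp, eval_mul, eval_C, eval_X, mul_one, mul_zero, hgcd, one_pow,
    exists_const, forall_const]
  refine and_congr_right fun _ => forall₃_congr fun n _ _ => exists_congr fun p =>
    and_congr_right fun hp => ?_
  simp [hndvd p hp]

theorem isGEMPoly_cyclotomic_one_iff (c : ℤ) :
    IsGEMPoly 1 1 ((cyclotomic 1 ℤ).comp (C c * X)) ↔ c ≠ 0 ∧ c ≠ 1 ∧ c ≠ 2 := by
  rw [isGEMPoly_one_cyclotomic_comp_iff]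
  simp only [cyclotomic_one, eval_sub, eval_X, eval_one, Nat.modEq_one, and_true, forall_const]
  constructor
  · rintro ⟨h1, h⟩
    refine ⟨?_, by lia, ?_⟩ <;> rintro rfl <;> obtain ⟨p, hp, hdvd⟩ := h 1 one_pos
    · exact (Nat.prime_iff_prime_int.1 hp).not_isUnit (isUnit_of_dvd_unit hdvd (by simp))
    · exact (Nat.prime_iff_prime_int.1 hp).not_isUnit (isUnit_of_dvd_unit hdvd (by simp))
  · rintro ⟨h0, h1, h2⟩
    refine ⟨by lia, fun n hn => ?_⟩
    simp only [Int.natCast_dvd]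
    refine Nat.exists_prime_and_dvd fun h => ?_
    have hdvd : (n : ℤ) ∣ 2 ∨ c * n = 0 := by
      rcases Int.natAbs_eq (c * n - 1) with h' | h' <;> rw [h] at h'
      · exact .inl ⟨c, by push_cast at h'; linarith⟩
      · exact .inr (by push_cast at h'; linarith)
    rcases hdvd with hdvd | h'
    · have hn2 := Nat.le_of_dvd two_pos (by exact_mod_cast hdvd)
      interval_cases n <;> lia
    · rcases mul_eq_zero.1 h' with h' | h' <;> lia

theorem Int.natAbs_eq_two_pow_or_exists_odd_prime_dvd {N : ℤ} (hN : N ≠ 0) :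
    (∃ k : ℕ, N.natAbs = 2 ^ k) ∨ ∃ p : ℕ, p.Prime ∧ (p : ℤ) ∣ N ∧ p ≡ 1 [MOD 2] := by
  by_contra! h
  refine h.1 _ (Nat.eq_prime_pow_of_unique_prime_dvd (p := 2) (by simpa using hN)
    fun {d} hd hdN => ?_)
  rw [← Int.natCast_dvd] at hdN
  refine hd.eq_two_or_odd'.resolve_right fun hodd => h.2 d hd hdN ?_
  exact Nat.odd_iff.1 hodd

theorem not_exists_odd_prime_dvd_two_pow {N : ℤ} {k : ℕ} (hN : N.natAbs = 2 ^ k) :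
    ¬ ∃ p : ℕ, p.Prime ∧ (p : ℤ) ∣ N ∧ p ≡ 1 [MOD 2] := by
  rintro ⟨p, hp, hdvd, hmod⟩
  rw [Int.natCast_dvd, hN] at hdvd
  rw [(Nat.prime_dvd_prime_iff_eq hp Nat.prime_two).1 (hp.dvd_of_dvd_pow hdvd)] at hmod
  exact absurd hmod (by decide)

theorem isGEMPoly_cyclotomic_two_iff (c : ℤ) :
    IsGEMPoly 1 2 ((cyclotomic 2 ℤ).comp (C c * X)) ↔
      (0 < c ∧ 2 ∣ c) ∨ (c < 0 ∧ ∀ k : ℕ, ¬ (-c) ∣ (2 ^ k + 1)) := by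
  rw [isGEMPoly_one_cyclotomic_comp_iff]
  simp only [cyclotomic_two, eval_add, eval_X, eval_one]
  constructor
  · rintro ⟨h1, h⟩
    rcases lt_trichotomy c 0 with hc | rfl | hc
    · refine .inr ⟨hc, fun k ⟨t, ht⟩ => ?_⟩
      have htpos : 0 < t := by
        have : (0 : ℤ) < 2 ^ k + 1 := by positivity
        rw [ht] at this
        exact (mul_pos_iff_of_pos_left (by lia)).1 this
      lift t to ℕ using htpos.le
      have htodd : Odd t := by
        rcases k with _ | k
        · have hdvd : (-c) ∣ 2 := ⟨t, by simpa using ht⟩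
          have := Int.le_of_dvd two_pos hdvd
          have hc2 : c = -2 := by lia
          subst hc2
          have : t = 1 := by lia
          simp [this]
        · by_contra hev
          obtain ⟨s, rfl⟩ := Nat.not_odd_iff_even.1 hev
          rw [pow_succ] at ht
          push_cast at ht
          have : (2 : ℤ) ∣ 1 := ⟨-c * s - 2 ^ k, by linarith⟩
          lia
      refine not_exists_odd_prime_dvd_two_pow (k := k) ?_
        (h t (by exact_mod_cast htpos) (Nat.odd_iff.1 htodd))
      rw [show c * (t : ℤ) + 1 = -(2 ^ k) by linarith, Int.natAbs_neg, Int.natAbs_pow]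
      rfl
    · exact absurd (h 1 one_pos rfl) (not_exists_odd_prime_dvd_two_pow (k := 0) (by simp))
    · refine .inl ⟨hc, ?_⟩
      by_contra hodd
      lift c to ℕ using hc.le
      have hc0 : 0 < c := by exact_mod_cast hc
      have hcop : Nat.Coprime 2 c := by
        rw [Nat.coprime_two_left, Nat.odd_iff]
        lia
      obtain ⟨t, ht⟩ := (Nat.modEq_iff_dvd' Nat.one_le_two_pow).1
        (Nat.ModEq.pow_totient hcop).symm
      have hpow : 2 ^ c.totient = c * t + 1 := by
        have := Nat.one_le_two_pow (n := c.totient)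
        lia
      have htot := Nat.totient_pos.2 hc0
      have htodd : Odd t := by
        have : Even (c * t + 1) := hpow ▸ (Nat.even_pow.2 ⟨even_two, htot.ne'⟩)
        have h2 : Odd (c * t) := by grind
        exact (Nat.odd_mul.1 h2).2
      refine not_exists_odd_prime_dvd_two_pow (k := c.totient) ?_
        (h t htodd.pos (Nat.odd_iff.1 htodd))
      rw [hpow]
      lia
  · rintro (⟨hc, h2⟩ | ⟨hc, h⟩)
    · refine ⟨by lia, fun n hn _ => ?_⟩
      have hpos : 0 < c * n := by positivity
      refine (Int.natAbs_eq_two_pow_or_exists_odd_prime_dvd (by lia)).resolve_left ?_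
      rintro ⟨_ | k, hk⟩
      · lia
      · rw [pow_succ] at hk
        have := h2.mul_right (n : ℤ)
        lia
    · have h1 := h 0
      have hc1 : c ≠ -1 := by rintro rfl; simp at h1
      refine ⟨by lia, fun n hn _ => ?_⟩
      have hlt : c * n ≤ c := by nlinarith
      refine (Int.natAbs_eq_two_pow_or_exists_odd_prime_dvd (by lia)).resolve_left ?_
      rintro ⟨k, hk⟩
      refine h k ⟨n, ?_⟩
      have : ((c * n + 1).natAbs : ℤ) = 2 ^ k := by exact_mod_cast hk
      lia

theorem isGEMPoly_cyclotomic_iff_of_two_lt {m : ℕ} (hm : 2 < m) (c : ℤ) :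
    IsGEMPoly 1 m ((cyclotomic m ℤ).comp (C c * X)) ↔
      2 ≤ |c| ∧ ¬ (m = 3 ∧ c = -2) ∧ ¬ (m = 6 ∧ c = 2) := by
  have hm0 : 0 < m := by lia
  rw [isGEMPoly_one_cyclotomic_comp_iff]
  constructor
  · rintro ⟨-, h⟩
    obtain ⟨p, hp, hdvd, hmod⟩ := h 1 one_pos rfl
    rw [Nat.cast_one, mul_one] at hdvd
    have hmp : m ∣ p - 1 := (Nat.modEq_iff_dvd' hp.one_le).1 hmod.symm
    refine ⟨?_, ?_, ?_⟩
    · by_contra! hc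
      have hpm : ¬ p ∣ m := fun hpm => by
        have := Nat.le_of_dvd (by have := hp.two_le; lia) (hpm.trans hmp)
        have := hp.two_le
        lia
      have hprim := isPrimitiveRoot_of_dvd_eval_cyclotomic hm0 hp hpm hdvd
      have := Fact.mk hp
      have hc0 : c ≠ 0 := by
        rintro rfl
        exact hprim.ne_zero hm0.ne' (by simp)
      have hc2 : (c : ZMod p) ^ 2 = 1 := by
        rcases (show c = 1 ∨ c = -1 by rw [abs_lt] at hc; lia) with rfl | rfl <;> simp
      have := Nat.le_of_dvd two_pos (hprim.dvd_of_pow_eq_one 2 hc2)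
      lia
    · rintro ⟨rfl, rfl⟩
      have h3 : p ∣ 3 := by
        simp only [cyclotomic_three, eval_add, eval_pow, eval_X, eval_one] at hdvd
        norm_num at hdvd
        exact_mod_cast hdvd
      rw [(Nat.prime_dvd_prime_iff_eq hp Nat.prime_three).1 h3] at hmp
      lia
    · rintro ⟨rfl, rfl⟩
      have h3 : p ∣ 3 := by
        simp only [cyclotomic_six, eval_add, eval_sub, eval_pow, eval_X, eval_one] at hdvd
        norm_num at hdvd
        exact_mod_cast hdvd
      rw [(Nat.prime_dvd_prime_iff_eq hp Nat.prime_three).1 h3] at hmp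
      lia
  · rintro ⟨hc, h3, h6⟩
    constructor
    · have := abs_sub_one_pow_totient_lt_abs_eval_cyclotomic hm hc
      rw [← abs_pos]
      exact (pow_pos (by lia) _).trans this
    · intro n hn hmod
      have hn1 : n = 1 ∨ m + 1 ≤ n := by
        have := Nat.le_of_dvd (n := n - 1) (m := m)
        have := (Nat.modEq_iff_dvd' hn).1 hmod.symm
        lia
      have habs : |c * n| = |c| * n := by rw [abs_mul, Nat.abs_cast]
      have hlarge : n = 1 ∨ 2 < |c * n| := by
        refine hn1.imp_right fun h => ?_
        rw [habs]
        nlinarith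
      refine exists_prime_dvd_eval_cyclotomic_modEq_one hm (by rw [habs]; nlinarith) ?_ ?_
      · rintro ⟨rfl, h⟩
        rcases hlarge with rfl | h'
        · exact h3 ⟨rfl, by simpa using h⟩
        · simp [h] at h'
      · rintro ⟨rfl, h⟩
        rcases hlarge with rfl | h'
        · exact h6 ⟨rfl, by simpa using h⟩
        · simp [h] at h'

/-- `Φ_m(cx)` is a Generalised Euclid–Mullin polynomial for the progression `1 mod m`
if and only if `c ∈ S(m)`. -/
theorem gemPoly_cyclotomic_iff (m : ℕ) (hm : 0 < m) (c : ℤ) :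
    IsGEMPoly 1 m ((cyclotomic m ℤ).comp (C c * X)) ↔ c ∈ Sset m := by
  rcases (show m = 1 ∨ m = 2 ∨ 2 < m by lia) with rfl | rfl | hm2
  · rw [isGEMPoly_cyclotomic_one_iff]
    simp [Sset]
  · rw [isGEMPoly_cyclotomic_two_iff]
    simp [Sset]
  · rw [isGEMPoly_cyclotomic_iff_of_two_lt hm2, le_abs, Sset, if_neg (by lia), if_neg (by lia)]
    split_ifs <;> simp only [Set.mem_ofPred_eq] <;> lia
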